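/- arXiv:1609.07854 — 3 statements merged into one kernel-verified Lean document; each statement's English description precedes it below -/
import Mathlib

section
/- Let n ≥ 1, let G be a positive definite Hermitian n×n complex matrix and let H be a Hermitian n×n complex matrix. If H is negative semidefinite, then the matrix (tr(G⁻¹H)) • G − H is negative semidefinite; likewise, if H is positive semidefinite, then (tr(G⁻¹H)) • G − H is positive semidefinite. (This is the pointwise matrix form of the statement that (Δ_g f)ω − i∂∂̄f ≤ 0 at a point where i∂∂̄f ≤ 0, and ≥ 0 where i∂∂̄f ≥ 0.) -/
open ComplexOrder

section

open scoped Matrix MatrixOrder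

theorem Matrix.PosSemidef.trace_smul_one_sub {m : Type*} [Fintype m] [DecidableEq m]
    {A : Matrix m m ℂ} (hA : A.PosSemidef) : (A.trace • (1 : Matrix m m ℂ) - A).PosSemidef := by
  let U : Matrix m m ℂ := (hA.1.eigenvectorUnitary : Matrix m m ℂ)
  have hUU : U * star U = 1 := Unitary.coe_mul_star_self hA.1.eigenvectorUnitary
  have hdiag : (Matrix.diagonal fun i ↦ A.trace - (hA.1.eigenvalues i : ℂ)).PosSemidef := by
    refine Matrix.PosSemidef.diagonal fun i ↦ ?_
    simp only [Pi.zero_apply, sub_nonneg]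
    rw [hA.1.trace_eq_sum_eigenvalues]
    exact Finset.single_le_sum (f := fun i ↦ (hA.1.eigenvalues i : ℂ))
      (fun j _ ↦ by exact_mod_cast hA.eigenvalues_nonneg j) (Finset.mem_univ i)
  have hA' : A = U * Matrix.diagonal (fun i ↦ (hA.1.eigenvalues i : ℂ)) * star U := by
    conv_lhs => rw [hA.1.spectral_theorem, Unitary.conjStarAlgAut_apply]
    rfl
  have key := hdiag.mul_mul_conjTranspose_same U
  rw [← Matrix.star_eq_conjTranspose, ← Matrix.diagonal_sub, Matrix.mul_sub, Matrix.sub_mul,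
    ← hA', ← Matrix.smul_one_eq_diagonal, Matrix.mul_smul, Matrix.smul_mul, Matrix.mul_one,
    hUU] at key
  exact key

theorem Matrix.PosDef.trace_inv_mul_smul_sub {m : Type*} [Fintype m] [DecidableEq m]
    {G H : Matrix m m ℂ} (hG : G.PosDef) (hH : H.PosSemidef) :
    ((G⁻¹ * H).trace • G - H).PosSemidef := by
  obtain ⟨B, hB, rfl⟩ :=
    CStarAlgebra.isStrictlyPositive_iff_eq_star_mul_self.mp hG.isStrictlyPositive
  have hdet : IsUnit B.det := B.isUnit_iff_isUnit_det.mp hB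
  have hBB : B⁻¹ * B = 1 := B.nonsing_inv_mul hdet
  have hBB' : Bᴴ * B⁻¹ᴴ = 1 := by rw [← Matrix.conjTranspose_mul, hBB, Matrix.conjTranspose_one]
  have htr : ((Bᴴ * B)⁻¹ * H).trace = (B⁻¹ᴴ * H * B⁻¹).trace := by
    rw [Matrix.mul_inv_rev, ← Matrix.conjTranspose_nonsing_inv, Matrix.mul_assoc,
      Matrix.trace_mul_comm]
  have key := (hH.conjTranspose_mul_mul_same B⁻¹).trace_smul_one_sub.conjTranspose_mul_mul_same B
  have hcancel : Bᴴ * (B⁻¹ᴴ * H * B⁻¹) * B = H := by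
    calc Bᴴ * (B⁻¹ᴴ * H * B⁻¹) * B = (Bᴴ * B⁻¹ᴴ) * H * (B⁻¹ * B) := by
          simp only [Matrix.mul_assoc]
      _ = H := by rw [hBB, hBB', Matrix.one_mul, Matrix.mul_one]
  rw [Matrix.mul_sub, Matrix.sub_mul, hcancel, Matrix.mul_smul, Matrix.smul_mul, Matrix.mul_one,
    ← htr] at key
  exact key

end

/-- If `G` is positive definite Hermitian and `H` is Hermitian, then
`(tr(G⁻¹ H)) • G − H` is negative semidefinite whenever `H` is negative
semidefinite, and positive semidefinite whenever `H` is positive semidefinite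
(matrix form of: `(Δ_g f) ω − i∂∂̄ f ≤ 0` where `i∂∂̄ f ≤ 0`, and `≥ 0` where
`i∂∂̄ f ≥ 0`). -/
theorem trace_smul_sub_semidef (n : ℕ) (hn : 1 ≤ n)
    (G H : Matrix (Fin n) (Fin n) ℂ) (hG : G.PosDef) (hH : H.IsHermitian) :
    ((-H).PosSemidef → (-((G⁻¹ * H).trace • G - H)).PosSemidef) ∧
    (H.PosSemidef → ((G⁻¹ * H).trace • G - H).PosSemidef) := by
  refine ⟨fun h ↦ ?_, hG.trace_inv_mul_smul_sub⟩
  have key := hG.trace_inv_mul_smul_sub h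
  rwa [Matrix.mul_neg, Matrix.trace_neg, neg_smul, ← neg_sub'] at key
end

section
/- Let n ≥ 2, τ > 0, C₀ > 0 and C₁ > 0. Then there exists a constant κ ∈ (0,1), depending only on n, τ, C₀ and C₁, with the following property. Whenever λ ∈ ℝⁿ satisfies λ₁ ≥ … ≥ λₙ and μ_k := (1/(n−1)) Σ_{i≠k} λ_i > 0 for all k with |Σ_{k=1}^n log μ_k| ≤ C₀; w ∈ ℝⁿ satisfies w_k ≥ τ for all k, with χ_k := (Σ_{j=1}^n w_j) − (n−1) w_k; and d ∈ ℝ satisfies |d| ≤ C₁; then, setting f_k = (1/(n−1)) Σ_{i≠k} (1/μ_i), at least one of the following two alternatives holds: (a) Σ_{k=1}^n f_k (χ_k − λ_k) − |d| > κ · Σ_{k=1}^n f_k; or (b) f_k > κ · Σ_{i=1}^n f_i for every k = 1, …, n. -/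
/-- The operator `v ↦ (c · Σ_{i ≠ k} v i)_k` is symmetric for the dot product. -/
theorem sum_mul_sum_erase_comm {ι : Type*} [Fintype ι] [DecidableEq ι] (c : ℝ) (a b : ι → ℝ) :
    ∑ k, (c * ∑ i ∈ Finset.univ.erase k, a i) * b k =
      ∑ i, a i * (c * ∑ k ∈ Finset.univ.erase i, b k) := by
  have erase_sum (v : ι → ℝ) (k : ι) : ∑ i ∈ Finset.univ.erase k, v i = (∑ i, v i) - v k := by
    rw [eq_sub_iff_add_eq, Finset.sum_erase_add _ _ (Finset.mem_univ k)]
  simp only [erase_sum, mul_sub, sub_mul, Finset.sum_sub_distrib]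
  rw [← Finset.sum_mul, ← Finset.mul_sum]
  congr 1
  · ring
  · exact Finset.sum_congr rfl fun _ _ => by ring

/-- The averaging operator fixes constants. -/
theorem average_erase_one {n : ℕ} (hn : 2 ≤ n) (k : Fin n) :
    (1 / ((n : ℝ) - 1)) * ∑ _i ∈ Finset.univ.erase k, (1 : ℝ) = 1 := by
  have h : (2 : ℝ) ≤ n := by exact_mod_cast hn
  have h' : (n : ℝ) - 1 ≠ 0 := by linarith
  rw [Finset.sum_const, Finset.card_erase_of_mem (Finset.mem_univ k), Finset.card_univ,
    Fintype.card_fin, nsmul_eq_mul, mul_one, Nat.cast_sub (by omega), Nat.cast_one]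
  field_simp

/-- Averaging `χ` over the indices different from `k` gives back `w k`. -/
theorem average_erase_chi {n : ℕ} (hn : 2 ≤ n) (w : Fin n → ℝ) (k : Fin n) :
    (1 / ((n : ℝ) - 1)) *
      ∑ i ∈ Finset.univ.erase k, ((∑ j, w j) - ((n : ℝ) - 1) * w i) = w k := by
  have h : (2 : ℝ) ≤ n := by exact_mod_cast hn
  have h' : (n : ℝ) - 1 ≠ 0 := by linarith
  have h1 := Finset.sum_erase_add Finset.univ w (Finset.mem_univ k)
  have h2 := average_erase_one hn k
  rw [Finset.sum_sub_distrib, ← Finset.mul_sum, ← mul_one (∑ j, w j), ← Finset.mul_sum, ← h1]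
  calc _ = ((∑ x ∈ Finset.univ.erase k, w x) + w k) *
        (1 / ((n : ℝ) - 1) * ∑ _i ∈ Finset.univ.erase k, (1 : ℝ)) -
        (1 / ((n : ℝ) - 1) * ((n : ℝ) - 1)) * ∑ x ∈ Finset.univ.erase k, w x := by ring
    _ = w k := by
      rw [h2, one_div_mul_cancel h']
      ring

/-- Positive numbers bounded by `M ≥ 1` whose logarithms sum to at least `-C` are bounded below. -/
theorem exp_le_of_sum_log {n : ℕ} {C M : ℝ} (hM : 1 ≤ M) {v : Fin n → ℝ}
    (hv : ∀ i, 0 < v i) (hvM : ∀ i, v i ≤ M) (hC : -C ≤ ∑ i, Real.log (v i)) (k : Fin n) :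
    Real.exp (-C - n * Real.log M) ≤ v k := by
  rw [← Real.le_log_iff_exp_le (hv k)]
  have h1 := Finset.sum_erase_add Finset.univ (fun i => Real.log (v i)) (Finset.mem_univ k)
  have h2 : ∑ i ∈ Finset.univ.erase k, Real.log (v i) ≤ n * Real.log M := by
    calc _ ≤ ∑ _i ∈ Finset.univ.erase k, Real.log M :=
          Finset.sum_le_sum fun i _ => Real.log_le_log (hv i) (hvM i)
      _ ≤ ∑ _i : Fin n, Real.log M :=
          Finset.sum_le_sum_of_subset_of_nonneg (Finset.erase_subset _ _)
            fun _ _ _ => Real.log_nonneg hM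
      _ = n * Real.log M := by simp
  linarith

/-- Proposition (dichotomy for the operator `f`): given `n ≥ 2`, `τ > 0`,
`C₀ > 0`, `C₁ > 0`, there is `κ ∈ (0,1)` depending only on these data such
that for all sorted `λ` with `μ = Pλ > 0` and `|Σ log μ_k| ≤ C₀`, all `w ≥ τ`
with `χ = P⁻¹ w`, and all `|d| ≤ C₁`, either
(a) `Σ f_k (χ_k − λ_k) − |d| > κ Σ f_k`, or (b) `f_k > κ Σ f_i` for all `k`. -/
theorem dichotomy (n : ℕ) (hn : 2 ≤ n) (τ C₀ C₁ : ℝ)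
    (hτ : 0 < τ) (hC₀ : 0 < C₀) (hC₁ : 0 < C₁) :
    ∃ κ : ℝ, 0 < κ ∧ κ < 1 ∧
      ∀ l : Fin n → ℝ, Antitone l →
        (∀ k, 0 < (1 / ((n : ℝ) - 1)) * ∑ i ∈ Finset.univ.erase k, l i) →
        |∑ k, Real.log
            ((1 / ((n : ℝ) - 1)) * ∑ i ∈ Finset.univ.erase k, l i)| ≤ C₀ →
        ∀ w : Fin n → ℝ, (∀ k, τ ≤ w k) →
        ∀ d : ℝ, |d| ≤ C₁ →
        ((∑ k, ((1 / ((n : ℝ) - 1)) * ∑ i ∈ Finset.univ.erase k,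
              1 / ((1 / ((n : ℝ) - 1)) * ∑ j ∈ Finset.univ.erase i, l j)) *
              (((∑ j, w j) - ((n : ℝ) - 1) * w k) - l k)) - |d|
            > κ * ∑ k, (1 / ((n : ℝ) - 1)) * ∑ i ∈ Finset.univ.erase k,
                1 / ((1 / ((n : ℝ) - 1)) * ∑ j ∈ Finset.univ.erase i, l j)) ∨
        (∀ k : Fin n,
          (1 / ((n : ℝ) - 1)) * ∑ i ∈ Finset.univ.erase k,
              1 / ((1 / ((n : ℝ) - 1)) * ∑ j ∈ Finset.univ.erase i, l j)
            > κ * ∑ k', (1 / ((n : ℝ) - 1)) * ∑ i ∈ Finset.univ.erase k',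
                1 / ((1 / ((n : ℝ) - 1)) * ∑ j ∈ Finset.univ.erase i, l j)) := by
  have hn2 : (2 : ℝ) ≤ n := by exact_mod_cast hn
  set M : ℝ := 1 + 2 * (n + C₁) / τ with hMdef
  have hM : 1 ≤ M := by
    have : 0 ≤ 2 * (n + C₁) / τ := by positivity
    linarith
  have hτM : n + C₁ < τ / 2 * M := by
    have : τ / 2 * M = τ / 2 + (n + C₁) := by
      rw [hMdef]
      field_simp
    linarith
  set c : ℝ := Real.exp (-C₀ - n * Real.log M)
  have hc : 0 < c := Real.exp_pos _
  set κ : ℝ := min (1 / 2) (min (τ / 2) (c / (2 * M)))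
  have hκ1 : κ ≤ 1 / 2 := min_le_left _ _
  have hκτ : κ ≤ τ / 2 := (min_le_right _ _).trans (min_le_left _ _)
  have hκc : κ ≤ c / (2 * M) := (min_le_right _ _).trans (min_le_right _ _)
  have hκ : 0 < κ := by positivity
  refine ⟨κ, hκ, by linarith, ?_⟩
  intro l _ hpos hlog w hw d hd
  set u : Fin n → ℝ := fun k => (1 / ((n : ℝ) - 1)) * ∑ i ∈ Finset.univ.erase k, l i
  have hu' : ∀ k, (1 / ((n : ℝ) - 1)) * ∑ i ∈ Finset.univ.erase k, l i = u k := fun _ => rfl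
  simp only [hu'] at hpos hlog ⊢
  have hv : ∀ k, 0 < 1 / u k := fun k => one_div_pos.2 (hpos k)
  have hsum : ∑ k, (1 / ((n : ℝ) - 1)) * ∑ i ∈ Finset.univ.erase k, 1 / u i = ∑ i, 1 / u i := by
    have := sum_mul_sum_erase_comm (1 / ((n : ℝ) - 1)) (fun i => 1 / u i) (fun _ => 1)
    simpa only [average_erase_one hn, mul_one] using this
  have hl : ∑ k, ((1 / ((n : ℝ) - 1)) * ∑ i ∈ Finset.univ.erase k, 1 / u i) * l k = n := by
    rw [sum_mul_sum_erase_comm]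
    simp only [hu', one_div_mul_cancel (hpos _).ne']
    simp
  have hχ : ∑ k, ((1 / ((n : ℝ) - 1)) * ∑ i ∈ Finset.univ.erase k, 1 / u i) *
      ((∑ j, w j) - ((n : ℝ) - 1) * w k) = ∑ i, 1 / u i * w i := by
    rw [sum_mul_sum_erase_comm]
    simp only [average_erase_chi hn]
  have hτS : τ * ∑ i, 1 / u i ≤ ∑ i, 1 / u i * w i := by
    rw [Finset.mul_sum]
    exact Finset.sum_le_sum fun i _ => by
      rw [mul_comm]
      exact mul_le_mul_of_nonneg_left (hw i) (hv i).le
  simp only [mul_sub _ _ (l _), Finset.sum_sub_distrib, hχ, hl, hsum]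
  set S := ∑ i, 1 / u i
  have hS0 : 0 ≤ S := Finset.sum_nonneg fun i _ => (hv i).le
  rcases lt_or_ge M S with hMS | hSM
  · left
    have h1 : κ * S ≤ τ / 2 * S := mul_le_mul_of_nonneg_right hκτ hS0
    have h2 : τ / 2 * M < τ / 2 * S := mul_lt_mul_of_pos_left hMS (by positivity)
    linarith
  · right
    intro k
    have hvM : ∀ i, 1 / u i ≤ M := fun i =>
      (Finset.single_le_sum (fun j _ => (hv j).le) (Finset.mem_univ i)).trans hSM
    have hvlog : -C₀ ≤ ∑ i, Real.log (1 / u i) := by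
      simp only [one_div, Real.log_inv, Finset.sum_neg_distrib]
      linarith [(abs_le.1 hlog).2]
    have hfk : c ≤ (1 / ((n : ℝ) - 1)) * ∑ i ∈ Finset.univ.erase k, 1 / u i := by
      calc c = c * ((1 / ((n : ℝ) - 1)) * ∑ _i ∈ Finset.univ.erase k, (1 : ℝ)) := by
            rw [average_erase_one hn, mul_one]
        _ = (1 / ((n : ℝ) - 1)) * ∑ _i ∈ Finset.univ.erase k, c := by
            rw [mul_left_comm, Finset.mul_sum]
            simp only [mul_one]
        _ ≤ _ := by
            refine mul_le_mul_of_nonneg_left ?_ (one_div_nonneg.2 (by linarith))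
            exact Finset.sum_le_sum fun i _ => exp_le_of_sum_log hM hv hvM hvlog i
    have hκS : κ * S ≤ c / 2 := by
      calc κ * S ≤ c / (2 * M) * M := mul_le_mul hκc hSM hS0 (by positivity)
        _ = c / 2 := by field_simp
    linarith
end

section
/- Let n ≥ 1, let A₀ be the diagonal n×n complex matrix with real diagonal entries d₁ > d₂ > … > dₙ, and let f : ℝⁿ → ℝ be differentiable at d = (d₁,…,dₙ). Fix δ > 0 such that the intervals (d_j − δ, d_j + δ) are pairwise disjoint, and let U be a neighborhood of A₀ in the real vector space of Hermitian n×n matrices on which every A ∈ U has exactly one eigenvalue λ_j(A) in (d_j − δ, d_j + δ) for each j. Then the function F(A) := f(λ₁(A), …, λₙ(A)) on U is differentiable at A₀ with derivative H ↦ Σ_{j=1}^n (∂f/∂x_j)(d) · H_{jj}; that is, F(A₀ + H) = f(d) + Σ_j f_j(d) H_{jj} + o(‖H‖) as H → 0 among Hermitian matrices. -/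
attribute [local instance] Matrix.normedAddCommGroup

/-- First-order perturbation of an eigenvalue of a diagonal matrix: if the eigenvalue `z` of
`diagonal d + H` stays at distance at least `δ` from every `d k` with `k ≠ j`, then
`z = d j + H j j` up to an error quadratic in `H`. -/
lemma norm_sub_diagonal_entry_le {ι : Type*} [Fintype ι] [DecidableEq ι]
    (d : ι → ℂ) (H : Matrix ι ι ℂ) (z : ℂ) (hz : z ∈ spectrum ℂ (Matrix.diagonal d + H))
    (j : ι) (δ : ℝ) (hδ : 0 < δ) (hgap : ∀ k, k ≠ j → δ ≤ ‖z - d k‖)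
    (hH : Fintype.card ι * ‖H‖ < δ) :
    ‖z - d j - H j j‖ ≤ (Fintype.card ι : ℝ) ^ 2 * ‖H‖ ^ 2 / δ := by
  rw [← Matrix.spectrum_toLin', ← Module.End.hasEigenvalue_iff_mem_spectrum] at hz
  obtain ⟨v, hv⟩ := hz.exists_hasEigenvector
  have hv0 : v ≠ 0 := hv.2
  have hvpos : 0 < ‖v‖ := norm_pos_iff.mpr hv0
  have hrow : ∀ k, (z - d k) * v k = ∑ l, H k l * v l := by
    intro k
    have h := congrFun hv.apply_eq_smul k
    rw [Matrix.toLin'_apply, Matrix.add_mulVec, Pi.add_apply, Matrix.mulVec_diagonal,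
      Pi.smul_apply, smul_eq_mul] at h
    change d k * v k + ∑ l, H k l * v l = z * v k at h
    linear_combination -h
  have hoff : ∀ k, k ≠ j → ‖v k‖ ≤ Fintype.card ι * ‖H‖ / δ * ‖v‖ := by
    intro k hk
    have hsum : ‖∑ l, H k l * v l‖ ≤ Fintype.card ι * (‖H‖ * ‖v‖) := by
      refine (norm_sum_le_of_le (f := fun l => H k l * v l) (n := fun _ => ‖H‖ * ‖v‖)
        Finset.univ fun l _ => ?_).trans (by simp)
      rw [norm_mul]
      exact mul_le_mul (H.norm_entry_le_entrywise_sup_norm) (norm_le_pi_norm v l)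
        (norm_nonneg _) (norm_nonneg _)
    rw [← hrow, norm_mul] at hsum
    rw [div_mul_eq_mul_div, le_div_iff₀ hδ]
    nlinarith [mul_le_mul_of_nonneg_right (hgap k hk) (norm_nonneg (v k))]
  have hratio : Fintype.card ι * ‖H‖ / δ < 1 := (div_lt_one hδ).mpr hH
  have hvj : ‖v j‖ = ‖v‖ := by
    refine le_antisymm (norm_le_pi_norm v j) ?_
    by_contra! hlt
    refine lt_irrefl ‖v‖ ((pi_norm_lt_iff hvpos).mpr fun k => ?_)
    by_cases hk : k = j
    · rwa [hk]
    · exact (hoff k hk).trans_lt (mul_lt_of_lt_one_left hvpos hratio)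
  have hsplit : (z - d j - H j j) * v j = ∑ l ∈ Finset.univ.erase j, H j l * v l := by
    have h := hrow j
    rw [← Finset.add_sum_erase _ _ (Finset.mem_univ j)] at h
    linear_combination h
  have hbound : ‖z - d j - H j j‖ * ‖v‖ ≤
      (Fintype.card ι : ℝ) ^ 2 * ‖H‖ ^ 2 / δ * ‖v‖ := by
    rw [← hvj, ← norm_mul, hsplit, hvj]
    calc ‖∑ l ∈ Finset.univ.erase j, H j l * v l‖
        ≤ ∑ l ∈ Finset.univ.erase j, ‖H‖ * (Fintype.card ι * ‖H‖ / δ * ‖v‖) := by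
          refine norm_sum_le_of_le _ fun l hl => ?_
          rw [norm_mul]
          exact mul_le_mul (H.norm_entry_le_entrywise_sup_norm)
            (hoff l (Finset.ne_of_mem_erase hl)) (norm_nonneg _) (norm_nonneg _)
      _ ≤ ∑ _l : ι, ‖H‖ * (Fintype.card ι * ‖H‖ / δ * ‖v‖) :=
          Finset.sum_le_sum_of_subset_of_nonneg (Finset.erase_subset _ _)
            fun _ _ _ => by positivity
      _ = (Fintype.card ι : ℝ) ^ 2 * ‖H‖ ^ 2 / δ * ‖v‖ := by
          rw [Finset.sum_const, Finset.card_univ, nsmul_eq_mul]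
          ring
  exact le_of_mul_le_mul_right hbound hvpos

/-- Gerhardt's first derivative formula `F^{ij} = δ_{ij} f_i` at a diagonal
matrix with distinct eigenvalues: if near `A₀ = diag(d₁ > … > dₙ)` every
Hermitian `A` has exactly one eigenvalue `λ_j(A)` in `(d_j − δ, d_j + δ)` for
each `j`, and `f : ℝⁿ → ℝ` is differentiable at `d`, then
`F(A) = f(λ₁(A), …, λₙ(A))` satisfies
`F(A₀ + H) = f(d) + Σ_j f_j(d) H_{jj} + o(‖H‖)` as `H → 0` among Hermitian
matrices. -/
theorem F_first_derivative (n : ℕ) (hn : 1 ≤ n) (d : Fin n → ℝ)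
    (hd : StrictAnti d) (δ : ℝ) (hδ : 0 < δ)
    (hdisj : ∀ j k : Fin n, j ≠ k →
      Disjoint (Set.Ioo (d j - δ) (d j + δ)) (Set.Ioo (d k - δ) (d k + δ)))
    (f : (Fin n → ℝ) → ℝ) (hf : DifferentiableAt ℝ f d)
    (ε : ℝ) (hε : 0 < ε) (lam : Fin n → Matrix (Fin n) (Fin n) ℂ → ℝ)
    (hlam : ∀ A : Matrix (Fin n) (Fin n) ℂ, A.IsHermitian →
      ‖A - Matrix.diagonal (fun j => (d j : ℂ))‖ < ε → ∀ j : Fin n,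
        ((lam j A : ℂ) ∈ spectrum ℂ A ∧
          lam j A ∈ Set.Ioo (d j - δ) (d j + δ) ∧
          ∀ μ : ℝ, (μ : ℂ) ∈ spectrum ℂ A →
            μ ∈ Set.Ioo (d j - δ) (d j + δ) → μ = lam j A)) :
    ∀ c : ℝ, 0 < c → ∃ η > 0,
      ∀ H : Matrix (Fin n) (Fin n) ℂ, H.IsHermitian → ‖H‖ < η →
        |f (fun j => lam j (Matrix.diagonal (fun j' => (d j' : ℂ)) + H)) - f d -
            ∑ j, fderiv ℝ f d (Pi.single j 1) * (H j j).re|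
          ≤ c * ‖H‖ := by
  intro c hc
  set L := fderiv ℝ f d
  have hn0 : (0 : ℝ) ≤ n := n.cast_nonneg
  have hc' : 0 < c / (2 * (n + 1)) := by positivity
  obtain ⟨r, hr, hrf⟩ := Metric.eventually_nhds_iff.mp
    ((hasFDerivAt_iff_isLittleO.mp hf.hasFDerivAt).def hc')
  refine ⟨min (min ε (δ / (n + 1))) (min (r / (n + 1)) (c * δ / (2 * (‖L‖ * n ^ 2 + 1)))),
    by positivity, fun H hH hHη => ?_⟩
  obtain ⟨⟨hHε, hHδ⟩, hHr, hHc⟩ : (‖H‖ < ε ∧ ‖H‖ < δ / (n + 1)) ∧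
      ‖H‖ < r / (n + 1) ∧ ‖H‖ < c * δ / (2 * (‖L‖ * n ^ 2 + 1)) := by
    simpa only [lt_min_iff] using hHη
  rw [lt_div_iff₀ (by positivity)] at hHδ hHr hHc
  have hH0 : 0 ≤ ‖H‖ := norm_nonneg H
  have hnH : n * ‖H‖ < δ := by nlinarith
  have hA : (Matrix.diagonal (fun j => (d j : ℂ)) + H).IsHermitian := by
    refine Matrix.IsHermitian.add ?_ hH
    exact Matrix.isHermitian_diagonal_of_self_adjoint _ (by ext j; simp)
  have hspec := hlam _ hA (by rwa [add_sub_cancel_left])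
  set x : Fin n → ℝ := fun j => lam j (Matrix.diagonal (fun j' => (d j' : ℂ)) + H)
  set h : Fin n → ℝ := fun j => (H j j).re
  have hquad : ‖x - d - h‖ ≤ (n : ℝ) ^ 2 * ‖H‖ ^ 2 / δ := by
    refine (pi_norm_le_iff_of_nonneg (by positivity)).mpr fun j => ?_
    obtain ⟨hmem, hIoo, -⟩ := hspec j
    have hgap : ∀ k, k ≠ j → δ ≤ ‖(x j : ℂ) - (d k : ℂ)‖ := by
      intro k hk
      rw [← Complex.ofReal_sub, Complex.norm_real, Real.norm_eq_abs]
      by_contra! hlt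
      rw [abs_lt] at hlt
      exact Set.disjoint_left.mp (hdisj j k hk.symm) hIoo
        ⟨by linarith [hlt.1], by linarith [hlt.2]⟩
    have hj := norm_sub_diagonal_entry_le _ H _ hmem j δ hδ hgap (by simpa using hnH)
    rw [Fintype.card_fin] at hj
    refine le_trans ?_ hj
    simpa [x, h] using Complex.abs_re_le_norm ((x j : ℂ) - d j - H j j)
  have hlin : ‖x - d - h‖ ≤ n * ‖H‖ := by
    refine hquad.trans ?_
    rw [div_le_iff₀ hδ]
    nlinarith [mul_le_mul_of_nonneg_left hnH.le (mul_nonneg hn0 hH0)]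
  have hh : ‖h‖ ≤ ‖H‖ := (pi_norm_le_iff_of_nonneg hH0).mpr fun j =>
    (Complex.abs_re_le_norm _).trans H.norm_entry_le_entrywise_sup_norm
  have hxd : ‖x - d‖ ≤ (n + 1) * ‖H‖ := by
    have := norm_add_le (x - d - h) h
    rw [sub_add_cancel] at this
    linarith
  have hrem : ‖f x - f d - L (x - d)‖ ≤ c / 2 * ‖H‖ := by
    refine (hrf (by rw [dist_eq_norm]; linarith)).trans
      ((mul_le_mul_of_nonneg_left hxd hc'.le).trans_eq ?_)
    field_simp
  have hLerr : ‖L (x - d - h)‖ ≤ c / 2 * ‖H‖ := by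
    refine (L.le_opNorm_of_le hquad).trans ?_
    rw [mul_div_assoc', div_le_iff₀ hδ]
    nlinarith [mul_le_mul_of_nonneg_right hHc.le hH0, sq_nonneg ‖H‖]
  have hLh : ∑ j, L (Pi.single j 1) * (H j j).re = L h := by
    have := L.toLinearMap.pi_apply_eq_sum_univ h
    simp only [ContinuousLinearMap.coe_coe, smul_eq_mul] at this
    rw [this]
    refine Finset.sum_congr rfl fun j _ => ?_
    rw [mul_comm]
    congr 2
    ext i
    simp [Pi.single_apply, eq_comm]
  rw [hLh, ← Real.norm_eq_abs]
  calc ‖f x - f d - L h‖ = ‖(f x - f d - L (x - d)) + L (x - d - h)‖ := by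
        rw [map_sub L (x - d) h]
        ring_nf
    _ ≤ c / 2 * ‖H‖ + c / 2 * ‖H‖ := norm_add_le_of_le hrem hLerr
    _ = c * ‖H‖ := by ring
end
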